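/- arXiv:1804.07712 — 2 statements merged into one kernel-verified Lean document; each statement's English description precedes it below -/
import Mathlib

section
/- For 0 < x < 1, π/sin(πx) = 1/x + Σ_{n=1}^∞ [1 + (−1)^{n+1}] η(n+1) x^n, where η(s) = (1 − 2^{1−s})ζ(s); equivalently 1/sin(z) = 1/z + 2 Σ_{n=1}^∞ (η(2n)/π^{2n}) z^{2n−1} for 0 < |z| < π. -/
noncomputable def etaR (n : ℕ) : ℝ := ∑' k : ℕ, (-1 : ℝ) ^ k / (k + 1) ^ n

theorem cot_hasSum_aux (w : ℝ) (h0 : w ≠ 0) (h1 : |w| < 1) :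
    HasSum (fun n : ℕ => 2 * w / (w ^ 2 - ((n : ℝ) + 1) ^ 2))
      (Real.pi * (Real.cos (Real.pi * w) / Real.sin (Real.pi * w)) - 1 / w) := by
  have hz : (w : ℂ) ∈ Complex.integerComplement := by
    rw [Complex.mem_integerComplement_iff]
    rintro ⟨n, hn⟩
    have hn' : (n : ℝ) = w := by exact_mod_cast hn
    rw [← hn'] at h1 h0
    have h2 : |n| < 1 := by exact_mod_cast h1
    rw [Int.abs_lt_one_iff] at h2
    simp [h2] at h0
  have h := (summable_cotTerm hz).hasSum
  have e : ∑' n, cotTerm (w : ℂ) n = _ := (cot_series_rep' hz).symm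
  rw [e] at h
  rw [← Complex.hasSum_ofReal]
  convert h using 1
  · funext n
    rw [cotTerm_identity hz]
    push_cast
    rw [show ((w : ℂ) + (n + 1)) * (w - (n + 1)) = w ^ 2 - (n + 1) ^ 2 by ring]
    ring
  · push_cast
    rw [Complex.cot_eq_cos_div_sin]

theorem alt_hasSum_aux (x : ℝ) (h0 : x ≠ 0) (h1 : |x| < 1) :
    HasSum (fun n : ℕ => (-1 : ℝ) ^ n * (2 * x / (((n : ℝ) + 1) ^ 2 - x ^ 2)))
      (Real.pi / Real.sin (Real.pi * x) - 1 / x) := by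
  have hA := cot_hasSum_aux x h0 h1
  have hB := cot_hasSum_aux (x / 2) (by simpa using h0) (by
    rw [abs_div, abs_two]; linarith [abs_nonneg x])
  set f : ℕ → ℝ := fun n : ℕ => 2 * x / (x ^ 2 - ((n : ℝ) + 1) ^ 2) with hf
  have hO : HasSum (fun n => f (2 * n + 1)) (2⁻¹ * (Real.pi *
      (Real.cos (Real.pi * (x / 2)) / Real.sin (Real.pi * (x / 2))) - 1 / (x / 2))) := by
    have hB2 := hB.mul_left 2⁻¹
    refine Eq.subst (motive := fun g : ℕ → ℝ => HasSum g _) (funext fun n => ?_) hB2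
    symm
    simp only [hf]
    push_cast
    rw [show (x ^ 2 - (2 * (n : ℝ) + 1 + 1) ^ 2) = 4 * ((x / 2) ^ 2 - ((n : ℝ) + 1) ^ 2) by ring]
    rw [mul_div_assoc, mul_div_assoc, div_mul_eq_div_div]
    ring
  have hE : HasSum (fun n => f (2 * n)) (∑' n, f (2 * n)) :=
    (hA.summable.comp_injective (i := fun n : ℕ => 2 * n)
      (fun a b hab => by simpa using hab)).hasSum
  have hsum := (hE.even_add_odd hO).unique hA
  have hE' : HasSum (fun n => (-1 : ℝ) ^ (2 * n + 1) * f (2 * n)) (-∑' n, f (2 * n)) := by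
    simpa [pow_succ, pow_mul] using hE.neg
  have hO' : HasSum (fun n => (-1 : ℝ) ^ (2 * n + 1 + 1) * f (2 * n + 1)) (2⁻¹ * (Real.pi *
      (Real.cos (Real.pi * (x / 2)) / Real.sin (Real.pi * (x / 2))) - 1 / (x / 2))) := by
    have e1 : ∀ n : ℕ, (-1 : ℝ) ^ (2 * n + 1 + 1) = 1 := fun n => by simp [pow_succ, pow_mul]
    simpa only [e1, one_mul] using hO
  have h := HasSum.even_add_odd (f := fun n => (-1 : ℝ) ^ (n + 1) * f n) hE' hO'
  convert h using 1
  · funext n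
    simp only [hf]
    rw [← neg_sub (x ^ 2), div_neg]
    ring
  · have hs : Real.sin (Real.pi * x) = 2 * Real.sin (Real.pi * (x / 2)) *
        Real.cos (Real.pi * (x / 2)) := by
      rw [← Real.sin_two_mul]; ring_nf
    have hc : Real.cos (Real.pi * x) = 2 * Real.cos (Real.pi * (x / 2)) ^ 2 - 1 := by
      rw [← Real.cos_two_mul]; ring_nf
    have hx := abs_lt.1 h1
    have hs0 : Real.sin (Real.pi * (x / 2)) ≠ 0 := by
      rw [Ne, Real.sin_eq_zero_iff_of_lt_of_lt]
      · simp [Real.pi_ne_zero, h0]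
      · nlinarith [Real.pi_pos]
      · nlinarith [Real.pi_pos]
    have hc0 : Real.cos (Real.pi * (x / 2)) ≠ 0 := by
      apply ne_of_gt
      apply Real.cos_pos_of_mem_Ioo
      constructor <;> nlinarith [Real.pi_pos]
    have key : Real.pi / Real.sin (Real.pi * x) =
        Real.pi * (Real.cos (Real.pi * (x / 2)) / Real.sin (Real.pi * (x / 2))) -
        Real.pi * (Real.cos (Real.pi * x) / Real.sin (Real.pi * x)) := by
      rw [hs, hc]
      field_simp
      ring
    have e2 : 1 / (x / 2) = 2 * (1 / x) := by field_simp
    rw [e2] at hsum ⊢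
    linarith

theorem csc_main_aux (x : ℝ) (h0 : x ≠ 0) (h1 : |x| < 1) :
    Real.pi / Real.sin (Real.pi * x) =
      1 / x + 2 * ∑' n : ℕ, etaR (2 * (n + 1)) * x ^ (2 * n + 1) := by
  have hA := alt_hasSum_aux x h0 h1
  have hx2 : x ^ 2 < 1 := by rwa [sq_lt_one_iff_abs_lt_one]
  set F : ℕ → ℕ → ℝ := fun k n => (-1 : ℝ) ^ k / ((k : ℝ) + 1) ^ (2 * (n + 1)) * x ^ (2 * n + 1)
    with hF
  have hS : Summable (Function.uncurry F) := by
    have s1 : Summable (fun k : ℕ => 1 / ((k : ℝ) + 1) ^ 2) := by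
      have := (summable_nat_add_iff 1).2 (Real.summable_one_div_nat_pow.2 one_lt_two)
      simpa using this
    have s2 : Summable (fun n : ℕ => |x| * (x ^ 2) ^ n) :=
      (summable_geometric_of_lt_one (sq_nonneg x) hx2).mul_left _
    have s := s1.mul_of_nonneg s2 (fun k => by positivity) (fun k => by positivity)
    refine Summable.of_norm_bounded s ?_
    rintro ⟨k, n⟩
    simp only [Function.uncurry, hF, norm_mul, norm_div, norm_pow, norm_neg, norm_one, one_pow,
      Real.norm_eq_abs]
    have hk : |(k : ℝ) + 1| = k + 1 := abs_of_nonneg (by positivity)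
    rw [hk]
    have e : |x| ^ (2 * n + 1) = |x| * (x ^ 2) ^ n := by
      rw [pow_succ, pow_mul, sq_abs]; ring
    rw [e]
    apply mul_le_mul_of_nonneg_right _ (by positivity)
    apply one_div_le_one_div_of_le (by positivity)
    exact pow_le_pow_right₀ (by linarith [(Nat.cast_nonneg k : (0 : ℝ) ≤ k)]) (by omega)
  have hrow : ∀ k : ℕ, 2 * ∑' n, F k n = (-1 : ℝ) ^ k * (2 * x / (((k : ℝ) + 1) ^ 2 - x ^ 2)) := by
    intro k
    have hk1 : (1 : ℝ) ≤ ((k : ℝ) + 1) ^ 2 :=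
      one_le_pow₀ (by linarith [(Nat.cast_nonneg k : (0 : ℝ) ≤ k)])
    have hr : x ^ 2 / ((k : ℝ) + 1) ^ 2 < 1 := by
      rw [div_lt_one (by positivity)]; linarith
    have hg := (hasSum_geometric_of_lt_one (by positivity) hr).mul_left
      ((-1 : ℝ) ^ k * x / ((k : ℝ) + 1) ^ 2)
    have : F k = fun n => (-1 : ℝ) ^ k * x / ((k : ℝ) + 1) ^ 2 * (x ^ 2 / ((k : ℝ) + 1) ^ 2) ^ n := by
      funext n
      simp only [hF]
      rw [div_pow, pow_mul, pow_succ (((k : ℝ) + 1) ^ 2), pow_succ x, pow_mul]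
      field_simp
    rw [this, hg.tsum_eq]
    have hne : ((k : ℝ) + 1) ^ 2 - x ^ 2 ≠ 0 := by
      apply ne_of_gt; linarith
    have e : 1 - x ^ 2 / ((k : ℝ) + 1) ^ 2 = (((k : ℝ) + 1) ^ 2 - x ^ 2) / ((k : ℝ) + 1) ^ 2 := by
      field_simp
    rw [e]
    field_simp
  have hcol : ∀ n : ℕ, etaR (2 * (n + 1)) * x ^ (2 * n + 1) = ∑' k, F k n := by
    intro n
    simp only [hF, etaR, tsum_mul_right]
  simp only [hcol]
  rw [hS.tsum_comm, ← tsum_mul_left]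
  simp only [hrow]
  rw [hA.tsum_eq]
  ring

theorem csc_series :
    (∀ x : ℝ, 0 < x → x < 1 →
      Real.pi / Real.sin (Real.pi * x) =
        1 / x + ∑' n : ℕ, (1 + (-1 : ℝ) ^ (n + 2)) * etaR (n + 2) * x ^ (n + 1)) ∧
    (∀ z : ℝ, 0 < |z| → |z| < Real.pi →
      1 / Real.sin z =
        1 / z + 2 * ∑' n : ℕ, etaR (2 * (n + 1)) / Real.pi ^ (2 * (n + 1)) * z ^ (2 * n + 1)) := by
  constructor
  · intro x hx0 hx1
    rw [csc_main_aux x hx0.ne' (by rw [abs_of_pos hx0]; exact hx1)]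
    congr 1
    have hinj : Function.Injective (fun n : ℕ => 2 * n) := fun a b hab => by simpa using hab
    rw [← hinj.tsum_eq (f := fun n : ℕ => (1 + (-1 : ℝ) ^ (n + 2)) * etaR (n + 2) * x ^ (n + 1)),
      ← tsum_mul_left]
    · apply tsum_congr
      intro n
      have : (-1 : ℝ) ^ (2 * n + 2) = 1 := by
        rw [show 2 * n + 2 = 2 * (n + 1) by ring, pow_mul]; simp
      rw [this, show 2 * (n + 1) = 2 * n + 2 by ring]
      ring
    · intro n hn
      rcases Nat.even_or_odd' n with ⟨m, rfl | rfl⟩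
      · exact ⟨m, rfl⟩
      · exfalso
        apply hn
        have : (-1 : ℝ) ^ (2 * m + 1 + 2) = -1 := by
          rw [show 2 * m + 1 + 2 = 2 * (m + 1) + 1 by ring, pow_succ, pow_mul]; simp
        simp only [this]
        simp
  · intro z hz0 hz1
    have hpi := Real.pi_pos
    have hz : z ≠ 0 := abs_pos.1 hz0
    have h := csc_main_aux (z / Real.pi) (div_ne_zero hz hpi.ne') (by
      rw [abs_div, abs_of_pos hpi, div_lt_one hpi]; exact hz1)
    rw [mul_div_cancel₀ z hpi.ne'] at h
    have e : ∑' n : ℕ, etaR (2 * (n + 1)) * (z / Real.pi) ^ (2 * n + 1) = Real.pi *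
        ∑' n : ℕ, etaR (2 * (n + 1)) / Real.pi ^ (2 * (n + 1)) * z ^ (2 * n + 1) := by
      rw [← tsum_mul_left]
      apply tsum_congr
      intro n
      rw [div_pow, show 2 * (n + 1) = 2 * n + 1 + 1 by ring, pow_succ Real.pi (2 * n + 1)]
      field_simp
    rw [e] at h
    have h' : Real.pi * (1 / Real.sin z) = Real.pi * (1 / z + 2 *
        ∑' n : ℕ, etaR (2 * (n + 1)) / Real.pi ^ (2 * (n + 1)) * z ^ (2 * n + 1)) := by
      rw [mul_one_div, h, one_div_div]
      ring
    exact mul_left_cancel₀ hpi.ne' h'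
end

section
/- For x ∈ (0, 1/2], define f(x) = [1 + x(1−x)]R(x) − π/sin(πx), where R(x) = −2γ − ψ(x) − ψ(1−x). Then f is strictly decreasing on (0, 1/2] with f(1/2) = 5 log 2 − π and lim_{x→0⁺} f(x) = 1; in particular 5 log 2 − π ≤ f(x) < 1 for all x ∈ (0,1/2], so R(x) ≥ (5 log 2 − π + π/sin(πx))/(1 + x(1−x)) with equality iff x = 1/2. -/
open Set Filter

noncomputable def digamma (x : ℝ) : ℝ := deriv (fun y => Real.log (Real.Gamma y)) x

noncomputable def RamanujanR (a : ℝ) : ℝ :=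
  -2 * Real.eulerMascheroniConstant - digamma a - digamma (1 - a)

noncomputable def fQiu (x : ℝ) : ℝ :=
  (1 + x * (1 - x)) * RamanujanR x - Real.pi / Real.sin (Real.pi * x)

open Topology

lemma dg_differentiable {x : ℝ} (hx : 0 < x) :
    DifferentiableAt ℝ (fun y => Real.log (Real.Gamma y)) x := by
  refine ((Real.differentiableAt_Gamma ?_).log (Real.Gamma_ne_zero ?_)) <;>
  exact fun m ↦ ne_of_gt (by linarith [(Nat.cast_nonneg m : (0:ℝ) ≤ m)])

lemma dg_eq {x : ℝ} (hx : 0 < x) : digamma x = deriv Real.Gamma x / Real.Gamma x := by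
  unfold digamma
  refine deriv.log (Real.differentiableAt_Gamma ?_) (Real.Gamma_pos_of_pos hx).ne'
  exact fun m ↦ ne_of_gt (by linarith [(Nat.cast_nonneg m : (0:ℝ) ≤ m)])

lemma dg_one : digamma 1 = -Real.eulerMascheroniConstant := by
  rw [dg_eq one_pos, Real.hasDerivAt_Gamma_one.deriv, Real.Gamma_one, div_one]

lemma dg_half : digamma (1 / 2) = -Real.eulerMascheroniConstant - 2 * Real.log 2 := by
  rw [dg_eq (by norm_num), Real.hasDerivAt_Gamma_one_half.deriv, Real.Gamma_one_half_eq]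
  have : √Real.pi ≠ 0 := by positivity
  field_simp
  ring

lemma dg_rec {x : ℝ} (hx : 0 < x) : digamma (x + 1) = digamma x + 1 / x := by
  unfold digamma
  rw [← deriv_comp_add_const, one_div, ← Real.deriv_log,
    ← deriv_fun_add (dg_differentiable hx) (Real.differentiableAt_log hx.ne')]
  apply EventuallyEq.deriv_eq
  filter_upwards [eventually_gt_nhds hx] with y hy
  rw [Real.Gamma_add_one hy.ne', Real.log_mul hy.ne' (Real.Gamma_pos_of_pos hy).ne', add_comm]

lemma dg_rec_nat {x : ℝ} (hx : 0 < x) (N : ℕ) :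
    digamma (x + N) = digamma x + ∑ k ∈ Finset.range N, 1 / (x + k) := by
  induction N with
  | zero => simp
  | succ n ih =>
    rw [Finset.sum_range_succ, ← add_assoc, ← ih, ← dg_rec (by positivity)]
    push_cast
    ring_nf

lemma dg_mono : MonotoneOn digamma (Ioi 0) :=
  ConvexOn.monotoneOn_deriv (f := fun y => Real.log (Real.Gamma y))
    Real.convexOn_log_Gamma (fun _ hx => dg_differentiable hx)

lemma dg_diff_tendsto {x : ℝ} (hx : 0 < x) (hx1 : x ≤ 1) :
    Tendsto (fun N : ℕ => digamma (1 + N) - digamma (x + N)) atTop (𝓝 0) := by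
  rw [← tendsto_add_atTop_iff_nat 1]
  refine squeeze_zero (g := fun N : ℕ => 1 / ((N : ℝ) + 1)) (fun N => ?_) (fun N => ?_)
    tendsto_one_div_add_atTop_nhds_zero_nat
  · rw [sub_nonneg]
    exact dg_mono (by simp only [mem_Ioi]; positivity) (by simp only [mem_Ioi]; positivity)
      (by linarith)
  · have h1 : digamma (1 + ((N + 1 : ℕ) : ℝ)) = digamma ((N : ℝ) + 1) + 1 / ((N : ℝ) + 1) := by
      rw [← dg_rec (by positivity)]; push_cast; ring_nf
    have h2 : digamma ((N : ℝ) + 1) ≤ digamma (x + ((N + 1 : ℕ) : ℝ)) :=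
      dg_mono (by simp only [mem_Ioi]; positivity) (by simp only [mem_Ioi]; positivity)
        (by push_cast; linarith)
    linarith

lemma dg_series {x : ℝ} (hx : 0 < x) (hx1 : x ≤ 1) :
    Tendsto (fun N : ℕ => ∑ k ∈ Finset.range N, (1 / (x + k) - 1 / (1 + k))) atTop
      (𝓝 (-Real.eulerMascheroniConstant - digamma x)) := by
  have h := (dg_diff_tendsto hx hx1).const_sub (digamma 1 - digamma x)
  rw [dg_one, sub_zero] at h
  refine h.congr fun N => ?_
  rw [dg_rec_nat hx, dg_rec_nat one_pos, Finset.sum_sub_distrib, dg_one]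
  ring

lemma R_series {x : ℝ} (hx : 0 < x) (hx1 : x < 1) :
    Tendsto (fun N : ℕ => ∑ n ∈ Finset.range N,
      ((2 * n + 1) / (n * (n + 1) + x * (1 - x)) - 2 / ((n : ℝ) + 1))) atTop
      (𝓝 (RamanujanR x)) := by
  have h := (dg_series hx hx1.le).add (dg_series (x := 1 - x) (by linarith) (by linarith))
  have e : RamanujanR x = -Real.eulerMascheroniConstant - digamma x +
    (-Real.eulerMascheroniConstant - digamma (1 - x)) := by unfold RamanujanR; ring
  rw [e]
  refine h.congr fun N => ?_
  rw [← Finset.sum_add_distrib]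
  refine Finset.sum_congr rfl fun n _ => ?_
  have hn : (0:ℝ) ≤ n := Nat.cast_nonneg n
  have h1 : x + n ≠ 0 := by positivity
  have h2 : 1 - x + n ≠ 0 := ne_of_gt (by linarith)
  have h3 : (n:ℝ) * (n + 1) + x * (1 - x) = (x + n) * (1 - x + n) := by ring
  rw [h3]
  have h4 : (1:ℝ) + n ≠ 0 := by positivity
  rw [add_comm (n:ℝ) 1]
  field_simp
  ring

lemma dg_refl {x : ℝ} (hx : 0 < x) (hx1 : x < 1) :
    digamma (1 - x) - digamma x = Real.pi * Real.cos (Real.pi * x) / Real.sin (Real.pi * x) := by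
  have hs : 0 < Real.sin (Real.pi * x) :=
    Real.sin_pos_of_pos_of_lt_pi (by positivity) (by nlinarith [Real.pi_pos])
  have hA : HasDerivAt (fun y => Real.log (Real.Gamma y) + Real.log (Real.Gamma (1 - y)))
      (digamma x + digamma (1 - x) * (-1)) x := by
    have h1 : HasDerivAt (fun y => Real.log (Real.Gamma y)) (digamma x) x :=
      (dg_differentiable hx).hasDerivAt
    have h2 : HasDerivAt (fun y => Real.log (Real.Gamma y)) (digamma (1 - x)) (1 - x) :=
      (dg_differentiable (by linarith)).hasDerivAt
    have h3 : HasDerivAt (fun y : ℝ => 1 - y) (-1) x := (hasDerivAt_id x).const_sub 1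
    exact h1.add (h2.comp x h3)
  have hB : HasDerivAt (fun y => Real.log Real.pi - Real.log (Real.sin (Real.pi * y)))
      (-(Real.cos (Real.pi * x) * Real.pi / Real.sin (Real.pi * x))) x := by
    have h1 : HasDerivAt (fun y : ℝ => Real.pi * y) Real.pi x := by
      simpa using (hasDerivAt_id x).const_mul Real.pi
    exact (h1.sin.log hs.ne').const_sub _
  have hE : (fun y => Real.log (Real.Gamma y) + Real.log (Real.Gamma (1 - y))) =ᶠ[𝓝 x]
      (fun y => Real.log Real.pi - Real.log (Real.sin (Real.pi * y))) := by
    filter_upwards [eventually_gt_nhds hx, eventually_lt_nhds hx1] with y hy hy1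
    have hs : 0 < Real.sin (Real.pi * y) :=
      Real.sin_pos_of_pos_of_lt_pi (by positivity) (by nlinarith [Real.pi_pos])
    rw [← Real.log_mul (Real.Gamma_pos_of_pos hy).ne' (Real.Gamma_pos_of_pos (by linarith)).ne',
      Real.Gamma_mul_Gamma_one_sub, Real.log_div Real.pi_pos.ne' hs.ne']
  have := hA.unique (hB.congr_of_eventuallyEq hE)
  have e : Real.pi * Real.cos (Real.pi * x) / Real.sin (Real.pi * x) =
    Real.cos (Real.pi * x) * Real.pi / Real.sin (Real.pi * x) := by ring
  rw [e]
  linarith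

lemma B_dg {x : ℝ} (hx : 0 < x) (hx1 : x < 1) :
    Real.pi / Real.sin (Real.pi * x) = (1 / 2) * (digamma (1 - x / 2) - digamma (x / 2) +
      (digamma ((1 + x) / 2) - digamma ((1 - x) / 2))) := by
  have h1 := dg_refl (x := x / 2) (by linarith) (by linarith)
  have h2 := dg_refl (x := (1 - x) / 2) (by linarith) (by linarith)
  have e1 : 1 - (1 - x) / 2 = (1 + x) / 2 := by ring
  have e2 : Real.pi * ((1 - x) / 2) = Real.pi / 2 - Real.pi * (x / 2) := by ring
  rw [e1, e2, Real.cos_pi_div_two_sub, Real.sin_pi_div_two_sub] at h2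
  rw [h1, h2]
  have e3 : Real.pi * x = 2 * (Real.pi * (x / 2)) := by ring
  rw [e3, Real.sin_two_mul]
  have hs : 0 < Real.sin (Real.pi * (x / 2)) :=
    Real.sin_pos_of_pos_of_lt_pi (by positivity) (by nlinarith [Real.pi_pos])
  have hc : 0 < Real.cos (Real.pi * (x / 2)) :=
    Real.cos_pos_of_mem_Ioo ⟨by nlinarith [Real.pi_pos], by nlinarith [Real.pi_pos]⟩
  have := Real.sin_sq_add_cos_sq (Real.pi * (x / 2))
  generalize Real.sin (Real.pi * (x / 2)) = s at *
  generalize Real.cos (Real.pi * (x / 2)) = c at *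
  field_simp
  linarith

lemma sum_range_two_mul (g : ℕ → ℝ) (N : ℕ) :
    ∑ n ∈ Finset.range (2 * N), g n = ∑ k ∈ Finset.range N, (g (2 * k) + g (2 * k + 1)) := by
  induction N with
  | zero => simp
  | succ n ih =>
    rw [show 2 * (n + 1) = 2 * n + 1 + 1 by ring, Finset.sum_range_succ, Finset.sum_range_succ,
      Finset.sum_range_succ, ih]
    ring

lemma B_series {x : ℝ} (hx : 0 < x) (hx1 : x < 1) :
    Tendsto (fun N : ℕ => ∑ n ∈ Finset.range (2 * N),
      ((-1) ^ n * ((2 * n + 1) / ((n : ℝ) * (n + 1) + x * (1 - x))))) atTop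
      (𝓝 (Real.pi / Real.sin (Real.pi * x))) := by
  have h := (((dg_series (x := x / 2) (by linarith) (by linarith)).sub
    (dg_series (x := 1 - x / 2) (by linarith) (by linarith))).add
    ((dg_series (x := (1 - x) / 2) (by linarith) (by linarith)).sub
    (dg_series (x := (1 + x) / 2) (by linarith) (by linarith)))).const_mul (1 / 2)
  rw [B_dg hx hx1]
  have e : (1 / 2 : ℝ) * (digamma (1 - x / 2) - digamma (x / 2) +
      (digamma ((1 + x) / 2) - digamma ((1 - x) / 2))) =
      1 / 2 * (-Real.eulerMascheroniConstant - digamma (x / 2) -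
        (-Real.eulerMascheroniConstant - digamma (1 - x / 2)) +
      (-Real.eulerMascheroniConstant - digamma ((1 - x) / 2) -
        (-Real.eulerMascheroniConstant - digamma ((1 + x) / 2)))) := by ring
  rw [e]
  refine h.congr fun N => ?_
  rw [sum_range_two_mul, ← Finset.sum_sub_distrib, ← Finset.sum_sub_distrib,
    ← Finset.sum_add_distrib, Finset.mul_sum]
  refine Finset.sum_congr rfl fun k _ => ?_
  have hk : (0:ℝ) ≤ k := Nat.cast_nonneg k
  rw [pow_succ, pow_mul]
  push_cast
  generalize (k : ℝ) = a at *
  have h1 : x + 2 * a ≠ 0 := by positivity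
  have h2 : 1 - x + 2 * a ≠ 0 := ne_of_gt (by linarith)
  have h3 : 1 + x + 2 * a ≠ 0 := by positivity
  have h4 : 2 - x + 2 * a ≠ 0 := ne_of_gt (by linarith)
  have e1 : 1 / (x / 2 + a) = 2 / (x + 2 * a) := by
    rw [show x / 2 + a = (x + 2 * a) / 2 by ring, one_div_div]
  have e2 : 1 / (1 - x / 2 + a) = 2 / (2 - x + 2 * a) := by
    rw [show 1 - x / 2 + a = (2 - x + 2 * a) / 2 by ring, one_div_div]
  have e3 : 1 / ((1 - x) / 2 + a) = 2 / (1 - x + 2 * a) := by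
    rw [show (1 - x) / 2 + a = (1 - x + 2 * a) / 2 by ring, one_div_div]
  have e4 : 1 / ((1 + x) / 2 + a) = 2 / (1 + x + 2 * a) := by
    rw [show (1 + x) / 2 + a = (1 + x + 2 * a) / 2 by ring, one_div_div]
  have e5 : (2 * (2 * a) + 1) / (2 * a * (2 * a + 1) + x * (1 - x))
      = 1 / (x + 2 * a) + 1 / (1 - x + 2 * a) := by
    rw [show 2 * a * (2 * a + 1) + x * (1 - x) = (x + 2 * a) * (1 - x + 2 * a) by ring]
    field_simp
    ring
  have e6 : (2 * (2 * a + 1) + 1) / ((2 * a + 1) * (2 * a + 1 + 1) + x * (1 - x))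
      = 1 / (1 + x + 2 * a) + 1 / (2 - x + 2 * a) := by
    rw [show (2 * a + 1) * (2 * a + 1 + 1) + x * (1 - x)
      = (1 + x + 2 * a) * (2 - x + 2 * a) by ring]
    field_simp
    ring
  rw [e1, e2, e3, e4, e5, e6]
  norm_num
  ring

lemma T_step {u v : ℝ} (hu : 0 < u) (huv : u < v) (n : ℕ) (s : ℝ) (hs : s ≤ 1) :
    ((1 + v) * ((2 * ((n + 1 : ℕ) : ℝ) + 1) / (((n + 1 : ℕ) : ℝ) * (((n + 1 : ℕ) : ℝ) + 1) + v)
        - 2 / (((n + 1 : ℕ) : ℝ) + 1))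
      - s * ((2 * ((n + 1 : ℕ) : ℝ) + 1) / (((n + 1 : ℕ) : ℝ) * (((n + 1 : ℕ) : ℝ) + 1) + v)))
    - ((1 + u) * ((2 * ((n + 1 : ℕ) : ℝ) + 1) / (((n + 1 : ℕ) : ℝ) * (((n + 1 : ℕ) : ℝ) + 1) + u)
        - 2 / (((n + 1 : ℕ) : ℝ) + 1))
      - s * ((2 * ((n + 1 : ℕ) : ℝ) + 1) / (((n + 1 : ℕ) : ℝ) * (((n + 1 : ℕ) : ℝ) + 1) + u)))
    ≤ (v - u) * (1 / ((n : ℝ) + 1) - 1 / ((n : ℝ) + 2)) := by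
  have hn : (0:ℝ) ≤ n := Nat.cast_nonneg n
  push_cast
  generalize (n : ℝ) = a at *
  have hm : 0 < (a + 1) * (a + 2) := by positivity
  have hv : 0 < v := hu.trans huv
  obtain ⟨m, hmm⟩ : ∃ m, m = (a + 1) * (a + 2) := ⟨_, rfl⟩
  rw [← hmm] at hm
  have e0 : (a + 1) * (a + 1 + 1) = m := by rw [hmm]; ring
  rw [e0]
  have h2 : a + 2 ≠ 0 := by positivity
  have h1 : a + 1 ≠ 0 := by positivity
  have key : (v - u) * ((2 * (a + 1) + 1) * (m - 1 + s) / ((m + u) * (m + v)))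
      ≤ (v - u) * ((2 * (a + 1) + 1) / m) := by
    refine mul_le_mul_of_nonneg_left ?_ (by linarith)
    rw [div_le_div_iff₀ (by positivity) hm, mul_assoc]
    refine mul_le_mul_of_nonneg_left ?_ (by positivity)
    nlinarith [mul_pos hm hu, mul_pos hm hv, mul_pos hu hv]
  have e1 : (v - u) * ((2 * (a + 1) + 1) / m) - 2 / (a + 1 + 1) * (v - u)
      = (v - u) * (1 / (a + 1) - 1 / (a + 2)) := by
    rw [hmm, show a + 1 + 1 = a + 2 by ring]
    field_simp
    ring
  rw [← e1]
  refine le_of_eq_of_le ?_ (sub_le_sub_right key _)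
  have h3 : m + u ≠ 0 := by positivity
  have h4 : m + v ≠ 0 := by positivity
  generalize 2 / (a + 1 + 1) = w
  field_simp
  ring

lemma partial_bound {u v : ℝ} (hu : 0 < u) (huv : u < v) (M : ℕ) :
    ∑ n ∈ Finset.range (M + 1),
      (((1 + v) * ((2 * (n : ℝ) + 1) / ((n : ℝ) * (n + 1) + v) - 2 / ((n : ℝ) + 1))
        - (-1) ^ n * ((2 * (n : ℝ) + 1) / ((n : ℝ) * (n + 1) + v)))
      - ((1 + u) * ((2 * (n : ℝ) + 1) / ((n : ℝ) * (n + 1) + u) - 2 / ((n : ℝ) + 1))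
        - (-1) ^ n * ((2 * (n : ℝ) + 1) / ((n : ℝ) * (n + 1) + u))))
    ≤ (v - u) * (-1 - 1 / ((M : ℝ) + 1)) := by
  have hv : 0 < v := hu.trans huv
  induction M with
  | zero =>
    simp
    field_simp
    linarith
  | succ k ih =>
    rw [Finset.sum_range_succ]
    have := T_step hu huv k ((-1) ^ (k + 1)) (by
      rcases neg_one_pow_eq_or ℝ (k + 1) with h | h <;> rw [h] <;> norm_num)
    refine (add_le_add ih this).trans (le_of_eq ?_)
    push_cast
    rw [show (k : ℝ) + 1 + 1 = k + 2 by ring]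
    ring

lemma f_series {x : ℝ} (hx : 0 < x) (hx1 : x < 1) :
    Tendsto (fun N : ℕ => ∑ n ∈ Finset.range (2 * N),
      ((1 + x * (1 - x)) * ((2 * (n : ℝ) + 1) / ((n : ℝ) * (n + 1) + x * (1 - x)) - 2 / ((n : ℝ) + 1))
        - (-1) ^ n * ((2 * (n : ℝ) + 1) / ((n : ℝ) * (n + 1) + x * (1 - x))))) atTop
      (𝓝 (fQiu x)) := by
  have h2 : Tendsto (fun N : ℕ => 2 * N) atTop atTop :=
    tendsto_id.const_mul_atTop' (by norm_num)
  have h := (((R_series hx hx1).comp h2).const_mul (1 + x * (1 - x))).sub (B_series hx hx1)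
  refine h.congr fun N => ?_
  simp only [Function.comp_apply]
  rw [Finset.mul_sum, ← Finset.sum_sub_distrib]

lemma f_anti : StrictAntiOn fQiu (Ioc 0 (1 / 2)) := by
  intro x hx y hy hxy
  obtain ⟨hx0, hx2⟩ := hx
  obtain ⟨hy0, hy2⟩ := hy
  have hu : 0 < x * (1 - x) := mul_pos hx0 (by linarith)
  have huv : x * (1 - x) < y * (1 - y) := by nlinarith
  have h := (f_series hy0 (by linarith)).sub (f_series hx0 (by linarith))
  have hle : fQiu y - fQiu x ≤ -(y * (1 - y) - x * (1 - x)) := by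
    refine le_of_tendsto h ?_
    filter_upwards [eventually_gt_atTop 0] with N hN
    rw [← Finset.sum_sub_distrib]
    obtain ⟨M, hM⟩ : ∃ M, 2 * N = M + 1 := ⟨2 * N - 1, by omega⟩
    rw [hM]
    refine (partial_bound hu huv M).trans ?_
    have : 0 < 1 / ((M : ℝ) + 1) := by positivity
    nlinarith
  linarith

lemma f_half : fQiu (1 / 2) = 5 * Real.log 2 - Real.pi := by
  unfold fQiu RamanujanR
  rw [show (1 : ℝ) - 1 / 2 = 1 / 2 by norm_num, dg_half,
    show Real.pi * (1 / 2) = Real.pi / 2 by ring, Real.sin_pi_div_two]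
  ring

lemma dg_cont : ContinuousAt digamma 1 := by
  have hd : DifferentiableOn ℂ Complex.Gamma {z | 0 < z.re} := fun z hz =>
    (Complex.differentiableAt_Gamma z (fun m hm => by
      have : (0:ℝ) < (-(m:ℂ)).re := hm ▸ hz
      simp at this
      linarith [(Nat.cast_nonneg m : (0:ℝ) ≤ m)])).differentiableWithinAt
  have ho : IsOpen {z : ℂ | 0 < z.re} := isOpen_lt continuous_const Complex.continuous_re
  have hc : ContinuousAt (deriv Complex.Gamma) ((1 : ℝ) : ℂ) :=
    (hd.deriv ho).continuousOn.continuousAt (ho.mem_nhds (by simp))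
  have hc2 : ContinuousAt (fun x : ℝ => (deriv Complex.Gamma (x : ℂ)).re / Real.Gamma x) 1 := by
    refine ContinuousAt.div ?_ ?_ (by simp)
    · exact Complex.continuous_re.continuousAt.comp
        (ContinuousAt.comp (f := fun x : ℝ => (x : ℂ)) hc Complex.continuous_ofReal.continuousAt)
    · exact Real.hasDerivAt_Gamma_one.continuousAt
  refine hc2.congr ?_
  filter_upwards [eventually_gt_nhds (zero_lt_one : (0:ℝ) < 1)] with x hx
  rw [dg_eq hx]
  congr 1
  have h := (hd.differentiableAt (ho.mem_nhds (by simpa using hx : (x:ℂ) ∈ {z : ℂ | 0 < z.re}))).hasDerivAt.real_of_complex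
  simp only [Complex.Gamma_ofReal, Complex.ofReal_re] at h
  exact h.deriv.symm

lemma csc_lim : Tendsto (fun x : ℝ => Real.pi / Real.sin (Real.pi * x) - 1 / x) (𝓝[>] 0) (𝓝 0) := by
  have hg : Tendsto (fun x : ℝ => Real.pi ^ 2 * x) (𝓝[>] 0) (𝓝 0) := by
    have : Continuous (fun x : ℝ => Real.pi ^ 2 * x) := by fun_prop
    simpa using (this.tendsto 0).mono_left nhdsWithin_le_nhds
  have hev : ∀ᶠ x : ℝ in 𝓝[>] 0, 0 < x ∧ x < 1 / 4 := by
    filter_upwards [self_mem_nhdsWithin,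
      nhdsWithin_le_nhds (eventually_lt_nhds (show (0:ℝ) < 1 / 4 by norm_num))] with x h1 h2
    exact ⟨h1, h2⟩
  have hpi := Real.pi_pos
  have hpi4 := Real.pi_le_four
  refine squeeze_zero' ?_ ?_ hg
  · filter_upwards [hev] with x ⟨h1, h2⟩
    have hs : 0 < Real.sin (Real.pi * x) :=
      Real.sin_pos_of_pos_of_lt_pi (by positivity) (by nlinarith)
    have := Real.sin_lt (show 0 < Real.pi * x by positivity)
    rw [sub_nonneg, div_le_div_iff₀ h1 hs]
    linarith
  · filter_upwards [hev] with x ⟨h1, h2⟩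
    have hs : 0 < Real.sin (Real.pi * x) :=
      Real.sin_pos_of_pos_of_lt_pi (by positivity) (by nlinarith)
    have h3 := Real.sin_gt_sub_cube (show 0 < Real.pi * x by positivity)
    have hy1 : Real.pi * x ≤ 1 := by nlinarith
    have hy0 : 0 < Real.pi * x := by positivity
    have e : Real.pi / Real.sin (Real.pi * x) - 1 / x
      = (Real.pi * x - Real.sin (Real.pi * x)) / (x * Real.sin (Real.pi * x)) := by
      field_simp
    rw [e, div_le_iff₀ (by positivity)]
    have e2 : Real.pi ^ 2 * x * (x * Real.sin (Real.pi * x))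
      = (Real.pi * x) ^ 2 * Real.sin (Real.pi * x) := by ring
    rw [e2]
    generalize Real.pi * x = y at *
    have h5 : y ^ 3 ≤ y := by nlinarith [mul_pos hy0 hy0]
    have h6 : 5 / 6 * y ≤ Real.sin y := by linarith
    have h7 : y ^ 2 * (5 / 6 * y) ≤ y ^ 2 * Real.sin y :=
      mul_le_mul_of_nonneg_left h6 (by positivity)
    nlinarith [pow_pos hy0 3]

lemma f_lim : Tendsto fQiu (𝓝[>] 0) (𝓝 1) := by
  have h1 : Tendsto (fun x : ℝ => digamma (x + 1)) (𝓝[>] 0) (𝓝 (digamma 1)) := by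
    have : Tendsto (fun x : ℝ => x + 1) (𝓝 0) (𝓝 1) := by
      have : Continuous (fun x : ℝ => x + 1) := by fun_prop
      simpa using this.tendsto 0
    exact (dg_cont.tendsto.comp this).mono_left nhdsWithin_le_nhds
  have h2 : Tendsto (fun x : ℝ => digamma (1 - x)) (𝓝[>] 0) (𝓝 (digamma 1)) := by
    have : Tendsto (fun x : ℝ => 1 - x) (𝓝 0) (𝓝 1) := by
      have : Continuous (fun x : ℝ => 1 - x) := by fun_prop
      simpa using this.tendsto 0
    exact (dg_cont.tendsto.comp this).mono_left nhdsWithin_le_nhds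
  have h3 : Tendsto (fun x : ℝ => 1 + x * (1 - x)) (𝓝[>] 0) (𝓝 1) := by
    have : Continuous (fun x : ℝ => 1 + x * (1 - x)) := by fun_prop
    simpa using (this.tendsto 0).mono_left nhdsWithin_le_nhds
  have h4 : Tendsto (fun x : ℝ => 1 - x) (𝓝[>] 0) (𝓝 1) := by
    have : Continuous (fun x : ℝ => 1 - x) := by fun_prop
    simpa using (this.tendsto 0).mono_left nhdsWithin_le_nhds
  have h := (h4.add (h3.mul ((h1.const_sub (-2 * Real.eulerMascheroniConstant)).sub h2))).sub csc_lim
  have e : (1 : ℝ) + 1 * (-2 * Real.eulerMascheroniConstant - digamma 1 - digamma 1) - 0 = 1 := by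
    rw [dg_one]; ring
  rw [e] at h
  refine h.congr' ?_
  filter_upwards [self_mem_nhdsWithin] with x hx
  have hx : 0 < x := hx
  unfold fQiu RamanujanR
  rw [dg_rec hx]
  generalize Real.pi / Real.sin (Real.pi * x) = b
  field_simp
  ring

theorem f_decreasing_bounds :
    StrictAntiOn fQiu (Ioc 0 (1 / 2)) ∧
    fQiu (1 / 2) = 5 * Real.log 2 - Real.pi ∧
    Tendsto fQiu (nhdsWithin 0 (Ioi 0)) (nhds 1) ∧
    (∀ x ∈ Ioc (0 : ℝ) (1 / 2),
      (5 * Real.log 2 - Real.pi ≤ fQiu x ∧ fQiu x < 1) ∧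
      (5 * Real.log 2 - Real.pi + Real.pi / Real.sin (Real.pi * x)) / (1 + x * (1 - x)) ≤
        RamanujanR x ∧
      ((5 * Real.log 2 - Real.pi + Real.pi / Real.sin (Real.pi * x)) / (1 + x * (1 - x)) =
        RamanujanR x ↔ x = 1 / 2)) := by
  refine ⟨f_anti, f_half, f_lim, fun x hx => ?_⟩
  have hhalf : (1 / 2 : ℝ) ∈ Ioc (0 : ℝ) (1 / 2) := by norm_num
  have hle : fQiu (1 / 2) ≤ fQiu x := f_anti.antitoneOn hx hhalf hx.2
  have hlt : fQiu x < 1 := by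
    have hx2 : x / 2 ∈ Ioc (0 : ℝ) (1 / 2) := ⟨by linarith [hx.1], by linarith [hx.1, hx.2]⟩
    have h1 : fQiu x < fQiu (x / 2) := f_anti hx2 hx (by linarith [hx.1])
    have h2 : fQiu (x / 2) ≤ 1 := by
      refine ge_of_tendsto f_lim ?_
      filter_upwards [self_mem_nhdsWithin,
        nhdsWithin_le_nhds (eventually_lt_nhds hx2.1)] with y hy hy2
      exact f_anti.antitoneOn ⟨hy, by linarith [hx2.2]⟩ hx2 hy2.le
    linarith
  have hp : 0 < 1 + x * (1 - x) := by nlinarith [hx.1, hx.2]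
  have hf : fQiu x = (1 + x * (1 - x)) * RamanujanR x - Real.pi / Real.sin (Real.pi * x) := rfl
  rw [f_half] at hle
  refine ⟨⟨hle, hlt⟩, ?_, ?_, ?_⟩
  · rw [div_le_iff₀ hp]
    linarith
  · intro h
    rw [div_eq_iff hp.ne'] at h
    have : fQiu x = fQiu (1 / 2) := by rw [f_half]; linarith
    exact f_anti.injOn hx hhalf this
  · intro h
    rw [div_eq_iff hp.ne']
    have : fQiu x = 5 * Real.log 2 - Real.pi := by rw [h, f_half]
    linarith
end
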